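/- Let (λ_n) and (λ̃_k) be nonincreasing summable sequences of positive reals with counting functions N, Ñ satisfying N(t) ~ φ(1/t)·s(ln(1/t))/t^{1/p} and Ñ(t) ~ φ̃(1/t)·s̃(ln(1/t))/t^{1/p} as t → 0+, where p > 0, φ, φ̃ are SVFs with ∫_1^∞ φ(τ) dτ/τ < ∞ and ∫_1^∞ φ̃(τ) dτ/τ < ∞, and s, s̃ are continuous, bounded, separated-from-zero periodic functions with periods T, T̃, of the form s(τ) = e^{−τ/p}ρ(τ), s̃(τ) = e^{−τ/p}ρ̃(τ) with ρ, ρ̃ monotone continuous. Assume further that ∫_1^∞ φ(σ)·m_{φ̃}(σ) dσ/σ < ∞ and ∫_1^∞ φ̃(σ)·m_{φ}(σ) dσ/σ < ∞, where m_{ψ}(σ) = sup_{τ > σ²} ψ(τ/σ)/ψ(τ). Then N_⊗(t) ~ [ φ(1/t)·s*(ln(1/t)) + φ̃(1/t)·s̃*(ln(1/t)) ] / t^{1/p} as t → 0+, where s*(τ) = Σ_k s(τ + ln λ̃_k)·λ̃_k^{1/p} and s̃*(τ) = Σ_n s̃(τ + ln λ_n)·λ_n^{1/p} (both series converge since the corresponding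 SVF integrals are finite). -/

import Mathlib

open MeasureTheory Filter Real Set Asymptotics

noncomputable section

/-- A function is *slowly varying at infinity* (SVF): it is positive on `(0, ∞)` and
`φ(cτ)/φ(τ) → 1` as `τ → ∞` for every constant `c > 0`. -/
def IsSVF (φ : ℝ → ℝ) : Prop :=
  (∀ x > 0, 0 < φ x) ∧ ∀ c > 0, Tendsto (fun τ => φ (c * τ) / φ τ) atTop (nhds 1)

/-- Mellin convolution `(φ∗ψ)(τ) = ∫_1^τ φ(σ) ψ(τ/σ) dσ/σ`. -/
def mellinConv (φ ψ : ℝ → ℝ) (τ : ℝ) : ℝ :=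
  ∫ σ in Set.Ioc (1:ℝ) τ, φ σ * ψ (τ / σ) / σ

/-- `h_{φ,ψ}(τ) = ∫_1^{√τ} φ(σ) ψ(τ/σ) dσ/σ`. -/
def mellinH (φ ψ : ℝ → ℝ) (τ : ℝ) : ℝ :=
  ∫ σ in Set.Ioc (1:ℝ) (Real.sqrt τ), φ σ * ψ (τ / σ) / σ

/-- `μ` is the Lebesgue–Stieltjes measure generated by the (monotone) function
`σ ↦ ρ (ln σ)` on `(0, ∞)`. -/
def IsLogStieltjes (μ : MeasureTheory.Measure ℝ) (ρ : ℝ → ℝ) : Prop :=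
  ∀ a b : ℝ, 0 < a → a ≤ b →
    μ (Set.Ioc a b) = ENNReal.ofReal (ρ (Real.log b) - ρ (Real.log a))

/-- `ν` is the Lebesgue–Stieltjes measure generated by the (monotone) function `ρ`. -/
def IsStieltjesOf (ν : MeasureTheory.Measure ℝ) (ρ : ℝ → ℝ) : Prop :=
  ∀ a b : ℝ, a ≤ b → ν (Set.Ioc a b) = ENNReal.ofReal (ρ b - ρ a)

/-- The almost Mellin convolution integral
`∫_A φ(τ/σ) ψ(σ) s(ln(τ/σ)) s̃(ln σ) d(ρ̃(ln σ))/ρ̃(ln σ)` over a region `A`,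
where `μ` is the Lebesgue–Stieltjes measure of `σ ↦ ρ̃(ln σ)`. -/
def almostMellinOn (A : Set ℝ) (φ ψ s st ρt : ℝ → ℝ) (μ : MeasureTheory.Measure ℝ)
    (τ : ℝ) : ℝ :=
  ∫ σ in A, φ (τ / σ) * ψ σ * s (Real.log (τ / σ)) * st (Real.log σ) / ρt (Real.log σ) ∂μ

/-- `(φs ∗ ψs̃)(τ)`: the almost Mellin convolution over `(1, τ]`. -/
def almostMellin (φ ψ s st ρt : ℝ → ℝ) (μ : MeasureTheory.Measure ℝ) (τ : ℝ) : ℝ :=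
  almostMellinOn (Set.Ioc 1 τ) φ ψ s st ρt μ τ

/-- `H[φs, ψs̃](τ)`: the almost Mellin convolution over `(1, √τ]`. -/
def almostH (φ ψ s st ρt : ℝ → ℝ) (μ : MeasureTheory.Measure ℝ) (τ : ℝ) : ℝ :=
  almostMellinOn (Set.Ioc 1 (Real.sqrt τ)) φ ψ s st ρt μ τ

/-- `H₁[φs, ψs̃](τ)`: the almost Mellin convolution over `(√τ, τ]`. -/
def almostH1 (φ ψ s st ρt : ℝ → ℝ) (μ : MeasureTheory.Measure ℝ) (τ : ℝ) : ℝ :=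
  almostMellinOn (Set.Ioc (Real.sqrt τ) τ) φ ψ s st ρt μ τ

/-- `(s ⋆ s̃)(η) = (1/T) ∫_0^T s(η − λ) s̃(λ) dλ`. -/
def periodConv (s st : ℝ → ℝ) (T η : ℝ) : ℝ :=
  (1 / T) * ∫ l in (0:ℝ)..T, s (η - l) * st l

/-- The eigenvalue counting function `N(t) = #{n : λ_n > t}` of a sequence. -/
def cntF (lam : ℕ → ℝ) (t : ℝ) : ℝ := (Nat.card {n : ℕ | t < lam n} : ℝ)

/-- The counting function `N_⊗(t) = #{(k, j) : λ_k λ̃_j > t}` of the tensor product. -/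
def cntTensor (lam lamt : ℕ → ℝ) (t : ℝ) : ℝ :=
  (Nat.card {q : ℕ × ℕ | t < lam q.1 * lamt q.2} : ℝ)

/-- `s_⊗(η) = (1/p)(s ⋆ s̃)(η) + (s ⋆ s̃)'(η)`. -/
def sOtimes (p T : ℝ) (s st : ℝ → ℝ) (η : ℝ) : ℝ :=
  (1 / p) * periodConv s st T η + deriv (periodConv s st T) η

/-- `m_ψ(σ) = sup_{τ > σ²} ψ(τ/σ)/ψ(τ)`. -/
def mSup (ψ : ℝ → ℝ) (σ : ℝ) : ℝ :=
  sSup {r : ℝ | ∃ τ : ℝ, σ ^ 2 < τ ∧ r = ψ (τ / σ) / ψ τ}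

/-- Karamata: an a.e. measurable function with vanishing increments at infinity has increments
over bounded ranges that are uniformly bounded near infinity. -/
lemma exists_forall_abs_increment_le {L : ℝ → ℝ} (hL : AEMeasurable L volume)
    (h : ∀ u, Tendsto (fun x => L (x + u) - L x) atTop (nhds 0)) :
    ∃ X, ∀ x ≥ X, ∀ u ∈ Icc (0 : ℝ) 2, |L (x + u) - L x| ≤ 2 := by
  have hmeas : ∀ x a : ℝ, AEStronglyMeasurable (fun v => min 1 |L (x + v) - a|) volume := by
    intro x a
    have h1 : AEMeasurable (fun v => L (x + v)) volume :=
      hL.comp_quasiMeasurePreserving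
        (measurePreserving_add_left volume x).quasiMeasurePreserving
    exact (aemeasurable_const.min (h1.sub_const a).abs).aestronglyMeasurable
  have hbd : ∀ x a v : ℝ, ‖min 1 |L (x + v) - a|‖ ≤ 1 := by
    intro x a v
    rw [Real.norm_of_nonneg (by positivity)]
    exact min_le_left _ _
  have hInt : ∀ x a c d : ℝ, IntervalIntegrable (fun v => min 1 |L (x + v) - a|) volume c d := by
    intro x a c d
    refine (intervalIntegrable_const (c := (1 : ℝ))).mono_fun (hmeas x a).restrict ?_
    filter_upwards with v
    simpa using hbd x a v
  have hlim : Tendsto (fun x => ∫ v in (0 : ℝ)..8, min 1 |L (x + v) - L x|) atTop (nhds 0) := by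
    have := intervalIntegral.tendsto_integral_filter_of_dominated_convergence
      (μ := volume) (a := 0) (b := 8) (l := atTop)
      (F := fun x v => min 1 |L (x + v) - L x|) (f := fun _ => (0 : ℝ)) (fun _ => 1)
      (Eventually.of_forall fun x => (hmeas x _).restrict)
      (Eventually.of_forall fun x => Eventually.of_forall fun v _ => hbd x _ v)
      intervalIntegrable_const
      (Eventually.of_forall fun v _ => by
        have := (tendsto_const_nhds (x := (1 : ℝ))).min (h v).abs
        simpa using this)
    simpa using this
  obtain ⟨X, hX⟩ := eventually_atTop.1 (hlim.eventually (gt_mem_nhds one_pos))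
  refine ⟨X, fun x hx u hu => ?_⟩
  by_contra! hc
  have h1 := hX x hx
  have h2 := hX (x + u) (by linarith [hu.1])
  have h3 : ∫ v in u..(u + 6), min 1 |L (x + v) - L x| ≤
      ∫ v in (0 : ℝ)..8, min 1 |L (x + v) - L x| :=
    intervalIntegral.integral_mono_interval hu.1 (by linarith) (by linarith [hu.2])
      (Eventually.of_forall fun v => by simp) (hInt _ _ _ _)
  have h4 : ∫ v in (0 : ℝ)..6, min 1 |L (x + u + v) - L (x + u)| ≤
      ∫ v in (0 : ℝ)..8, min 1 |L (x + u + v) - L (x + u)| :=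
    intervalIntegral.integral_mono_interval le_rfl (by linarith) (by linarith)
      (Eventually.of_forall fun v => by simp) (hInt _ _ _ _)
  have h5 : ∫ v in u..(u + 6), min 1 |L (x + v) - L x| =
      ∫ v in (0 : ℝ)..6, min 1 |L (x + u + v) - L x| := by
    have := intervalIntegral.integral_comp_add_left (a := 0) (b := 6)
      (fun v => min 1 |L (x + v) - L x|) u
    simp only [add_zero] at this
    rw [← this]
    simp only [add_assoc]
  have h6 : ∫ v in (0 : ℝ)..6, (1 : ℝ) ≤ ∫ v in (0 : ℝ)..6,
      (min 1 |L (x + u + v) - L x| + min 1 |L (x + u + v) - L (x + u)|) := by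
    refine intervalIntegral.integral_mono_on (by norm_num) intervalIntegrable_const
      ((hInt _ _ _ _).add (hInt _ _ _ _)) fun v _ => ?_
    have htri : |L (x + u) - L x| ≤ |L (x + u + v) - L x| + |L (x + u + v) - L (x + u)| := by
      have := abs_sub_le (L (x + u)) (L (x + u + v)) (L x)
      rw [abs_sub_comm (L (x + u)) (L (x + u + v))] at this
      linarith
    rcases le_total 1 |L (x + u + v) - L x| with h | h
    · rw [min_eq_left h]
      have : 0 ≤ min 1 |L (x + u + v) - L (x + u)| := by positivity
      linarith
    · rw [min_eq_left (by linarith : 1 ≤ |L (x + u + v) - L (x + u)|)]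
      have : 0 ≤ min 1 |L (x + u + v) - L x| := by positivity
      linarith
  rw [intervalIntegral.integral_add (hInt _ _ _ _) (hInt _ _ _ _)] at h6
  norm_num at h6
  linarith

/-- Values along an arithmetic progression of an almost decreasing integrable function are
summable. -/
lemma summable_of_integrableOn_of_almost_decreasing {P : ℝ → ℝ} {X C : ℝ} (hX : 0 ≤ X)
    (hP : IntegrableOn P (Ici 0)) (h0 : ∀ x ≥ X, 0 ≤ P x)
    (hC : ∀ x ≥ X, ∀ u ∈ Icc (0 : ℝ) 1, P (x + u) ≤ C * P x) :
    Summable fun j : ℕ => P (X + j) := by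
  rw [← summable_nat_add_iff 1]
  have hii : ∀ a b : ℝ, X ≤ a → X ≤ b → IntervalIntegrable P volume a b := by
    intro a b ha hb
    refine (hP.mono_set ?_).intervalIntegrable
    intro z hz
    have := hz.1
    have : X ≤ min a b := le_min ha hb
    simp only [mem_Ici]
    exact (hX.trans this).trans hz.1
  have hn : ∀ j : ℕ, X ≤ X + j := fun j => by simp
  refine summable_of_sum_range_le (c := C * ∫ x in Ici X, P x)
    (fun j => h0 _ (hn _)) fun n => ?_
  have hC0 : ∀ x ≥ X, 0 ≤ C * P x := fun x hx =>
    (h0 (x + 0) (by simpa using hx)).trans (hC x hx 0 (by simp))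
  have key : ∀ j : ℕ, P (X + ((j + 1 : ℕ) : ℝ)) ≤
      ∫ x in (X + (j : ℝ))..(X + ((j + 1 : ℕ) : ℝ)), C * P x := by
    intro j
    have hle : X + (j : ℝ) ≤ X + ((j + 1 : ℕ) : ℝ) := by push_cast; linarith
    have := intervalIntegral.integral_mono_on (μ := volume) hle
      (intervalIntegrable_const (c := P (X + ((j + 1 : ℕ) : ℝ))))
      ((hii _ _ (hn j) (hn (j + 1))).const_mul C) fun x hx => by
        have := hC x ((hn j).trans hx.1) (X + ((j + 1 : ℕ) : ℝ) - x)
          ⟨by linarith [hx.2], by have := hx.1; push_cast; linarith⟩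
        simpa using this
    simpa using this
  calc ∑ j ∈ Finset.range n, P (X + ((j + 1 : ℕ) : ℝ))
      ≤ ∑ j ∈ Finset.range n, ∫ x in (X + (j : ℝ))..(X + ((j + 1 : ℕ) : ℝ)), C * P x :=
        Finset.sum_le_sum fun j _ => key j
    _ = ∫ x in X..(X + n), C * P x := by
        have := intervalIntegral.sum_integral_adjacent_intervals (f := fun x => C * P x)
          (μ := volume) (a := fun j : ℕ => X + (j : ℝ)) (n := n)
          fun j _ => (hii _ _ (hn j) (hn (j + 1))).const_mul C
        simpa using this
    _ ≤ ∫ x in Ici X, C * P x := by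
        rw [intervalIntegral.integral_of_le (hn n)]
        refine setIntegral_mono_set ((hP.mono_set (Ici_subset_Ici.2 hX)).const_mul C) ?_ ?_
        · filter_upwards [ae_restrict_mem measurableSet_Ici] with x hx using hC0 x hx
        · exact (Ioc_subset_Ioi_self.trans Ioi_subset_Ici_self).eventuallyLE
    _ = C * ∫ x in Ici X, P x := integral_const_mul _ _

lemma tendsto_zero_of_integrableOn_of_almost_decreasing {P : ℝ → ℝ} {X C : ℝ} (hX : 0 ≤ X)
    (hP : IntegrableOn P (Ici 0)) (h0 : ∀ x ≥ X, 0 ≤ P x)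
    (hC : ∀ x ≥ X, ∀ u ∈ Icc (0 : ℝ) 1, P (x + u) ≤ C * P x) :
    Tendsto P atTop (nhds 0) := by
  have h1 := (summable_of_integrableOn_of_almost_decreasing hX hP h0 hC).tendsto_atTop_zero
  have h2 : Tendsto (fun x : ℝ => C * P (X + (⌊x - X⌋₊ : ℕ))) atTop (nhds 0) := by
    have := (h1.comp (tendsto_nat_floor_atTop.comp (tendsto_atTop_add_const_right atTop (-X)
      tendsto_id))).const_mul C
    simpa [Function.comp_def, sub_eq_add_neg] using this
  refine squeeze_zero' ?_ ?_ h2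
  · filter_upwards [eventually_ge_atTop X] with x hx using h0 x hx
  · filter_upwards [eventually_ge_atTop X] with x hx
    have hf := Nat.floor_le (sub_nonneg.2 hx)
    have hl := Nat.lt_floor_add_one (x - X)
    have := hC (X + (⌊x - X⌋₊ : ℕ)) (by simp) (x - (X + (⌊x - X⌋₊ : ℕ)))
      ⟨by linarith, by linarith⟩
    simpa using this

lemma summable_of_fiber_card_le {W w c : ℕ → ℝ} {j : ℕ → ℕ} (hW : ∀ k, 0 ≤ W k)
    (hw : ∀ i, 0 ≤ w i) (hc : ∀ i, 0 ≤ c i)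
    (hWw : ∀ k, W k ≠ 0 → W k ≤ w (j k))
    (hcard : ∀ i, ∀ S : Finset ℕ, (∀ k ∈ S, j k = i ∧ W k ≠ 0) → (S.card : ℝ) ≤ c i)
    (hs : Summable fun i => c i * w i) : Summable W := by
  refine summable_of_sum_le hW (c := ∑' i, c i * w i) fun S => ?_
  rw [← Finset.sum_filter_ne_zero, ← Finset.sum_fiberwise_of_maps_to
    (t := (S.filter (W · ≠ 0)).image j) (g := j) fun k hk => Finset.mem_image_of_mem _ hk]
  refine le_trans (Finset.sum_le_sum fun i _ => ?_)
    (hs.sum_le_tsum _ fun i _ => mul_nonneg (hc i) (hw i))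
  calc _ ≤ ∑ k ∈ (S.filter (W · ≠ 0)).filter (j · = i), w i := by
        refine Finset.sum_le_sum fun k hk => ?_
        simp only [Finset.mem_filter] at hk
        exact hk.2 ▸ hWw k hk.1.2
    _ ≤ c i * w i := by
        rw [Finset.sum_const, nsmul_eq_mul]
        refine mul_le_mul_of_nonneg_right (hcard i _ fun k hk => ?_) (hw i)
        simp only [Finset.mem_filter] at hk
        exact ⟨hk.2, hk.1.2⟩

lemma cntF_eq_ncard (lam : ℕ → ℝ) (t : ℝ) : cntF lam t = ({n | t < lam n}.ncard : ℝ) := rfl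

lemma integrableOn_comp_exp {g : ℝ → ℝ} (hg : IntegrableOn (fun τ => g τ / τ) (Ici 1)) :
    IntegrableOn (fun x => g (exp x)) (Ici 0) := by
  have himg : exp '' Ici 0 = Ici 1 := by
    ext y
    constructor
    · rintro ⟨x, hx, rfl⟩
      exact one_le_exp hx
    · intro hy
      exact ⟨log y, log_nonneg hy, exp_log (one_pos.trans_le hy)⟩
  rw [← himg, integrableOn_image_iff_integrableOn_abs_deriv_smul measurableSet_Ici
    (fun x _ => (hasDerivAt_exp x).hasDerivWithinAt) exp_injective.injOn] at hg
  refine hg.congr_fun (fun x _ => ?_) measurableSet_Ici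
  simp only [abs_exp, smul_eq_mul]
  field_simp

lemma IsSVF.tendsto_add {φ : ℝ → ℝ} (hφ : IsSVF φ) (u : ℝ) :
    Tendsto (fun x => φ (exp (x + u)) / φ (exp x)) atTop (nhds 1) := by
  have := (hφ.2 (exp u) (exp_pos u)).comp tendsto_exp_atTop
  simpa [Function.comp_def, exp_add, mul_comm] using this

/-- On a logarithmic scale, the values of `φ` at points at distance at most `2` in `[X, ∞)` are
comparable up to the constant `C`. -/
def LogComparable (φ : ℝ → ℝ) (C X : ℝ) : Prop :=
  ∀ x ≥ X, ∀ u ∈ Icc (0 : ℝ) 2,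
    φ (exp (x + u)) ≤ C * φ (exp x) ∧ φ (exp x) ≤ C * φ (exp (x + u))

lemma LogComparable.mono {φ : ℝ → ℝ} {C X X' : ℝ} (h : LogComparable φ C X) (hX : X ≤ X') :
    LogComparable φ C X' :=
  fun x hx => h x (hX.trans hx)

lemma IsSVF.exists_logComparable {φ : ℝ → ℝ} (hφ : IsSVF φ)
    (hi : IntegrableOn (fun τ => φ τ / τ) (Ici 1)) : ∃ X, LogComparable φ (exp 2) X := by
  set L : ℝ → ℝ := (Ici (0 : ℝ)).indicator fun x => log (φ (exp x)) with hLdef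
  have hL0 : ∀ x, 0 ≤ x → L x = log (φ (exp x)) := fun x hx =>
    indicator_of_mem (mem_Ici.2 hx) _
  have hL : AEMeasurable L volume := by
    rw [hLdef, aemeasurable_indicator_iff measurableSet_Ici]
    exact measurable_log.comp_aemeasurable (integrableOn_comp_exp hi).aemeasurable
  have hpos : ∀ x, 0 < φ (exp x) := fun x => hφ.1 _ (exp_pos x)
  obtain ⟨X, hX⟩ := exists_forall_abs_increment_le hL fun u => by
    have h1 := (continuousAt_log one_ne_zero).tendsto.comp (hφ.tendsto_add u)
    rw [log_one] at h1
    refine h1.congr' ?_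
    filter_upwards [eventually_ge_atTop 0, eventually_ge_atTop (-u)] with x hx hxu
    rw [hL0 x hx, hL0 _ (by linarith), Function.comp_apply,
      log_div (hpos _).ne' (hpos _).ne']
  refine ⟨max X 0, fun x hx u hu => ?_⟩
  have hx0 : 0 ≤ x := (le_max_right _ _).trans hx
  have h := hX x ((le_max_left _ _).trans hx) u hu
  rw [hL0 x hx0, hL0 _ (by linarith [hu.1]), abs_le] at h
  constructor
  · rw [← log_le_log_iff (hpos _) (mul_pos (exp_pos 2) (hpos _)),
      log_mul (exp_pos 2).ne' (hpos _).ne', log_exp]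
    linarith
  · rw [← log_le_log_iff (hpos _) (mul_pos (exp_pos 2) (hpos _)),
      log_mul (exp_pos 2).ne' (hpos _).ne', log_exp]
    linarith

section mSup

variable {ψ : ℝ → ℝ} {C X : ℝ}

lemma mSup_nonneg (hψ : ∀ x > 0, 0 < ψ x) {σ : ℝ} (hσ : 0 < σ) : 0 ≤ mSup ψ σ := by
  refine Real.sSup_nonneg ?_
  rintro r ⟨τ, hτ, rfl⟩
  have hτ0 : 0 < τ := (by positivity : 0 < σ ^ 2).trans hτ
  exact (div_pos (hψ _ (div_pos hτ0 hσ)) (hψ _ hτ0)).le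

lemma LogComparable.le_pow (h : LogComparable ψ C X) (hC : 0 ≤ C) {x : ℝ} (hx : X ≤ x) (n : ℕ) :
    ∀ u : ℝ, 0 ≤ u → u ≤ 2 * (n + 1) → ψ (exp x) ≤ C ^ (n + 1) * ψ (exp (x + u)) := by
  induction n with
  | zero =>
    intro u hu0 hu
    simpa using (h x hx u ⟨hu0, by simpa using hu⟩).2
  | succ n ih =>
    intro u hu0 hu
    push_cast at hu
    have hn : (0 : ℝ) ≤ n := n.cast_nonneg
    rcases le_total u 2 with h2 | h2
    · have e1 := ih 0 le_rfl (by positivity)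
      have e2 := (h x hx u ⟨hu0, h2⟩).2
      rw [add_zero] at e1
      calc ψ (exp x) ≤ C ^ (n + 1) * ψ (exp x) := e1
        _ ≤ C ^ (n + 1) * (C * ψ (exp (x + u))) := by gcongr
        _ = _ := by ring
    · have e1 := ih (u - 2) (by linarith) (by linarith)
      have e2 := (h (x + (u - 2)) (by linarith) 2 (by simp)).2
      rw [show x + (u - 2) + 2 = x + u by ring] at e2
      calc ψ (exp x) ≤ C ^ (n + 1) * ψ (exp (x + (u - 2))) := e1
        _ ≤ C ^ (n + 1) * (C * ψ (exp (x + u))) := by gcongr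
        _ = _ := by ring

lemma bddAbove_mSup (hψ : ∀ x > 0, 0 < ψ x) (h : LogComparable ψ C X) (hC : 0 ≤ C) (hX : 0 ≤ X)
    {x : ℝ} (hx : X ≤ x) :
    BddAbove {r : ℝ | ∃ τ : ℝ, exp x ^ 2 < τ ∧ r = ψ (τ / exp x) / ψ τ} := by
  obtain ⟨n, hn⟩ := exists_nat_ge x
  refine ⟨C ^ (n + 1), ?_⟩
  rintro r ⟨τ, hτ, rfl⟩
  have hτ0 : 0 < τ := (by positivity : 0 < exp x ^ 2).trans hτ
  have hlog : 2 * x < log τ := by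
    rw [lt_log_iff_exp_lt hτ0, two_mul, exp_add, ← sq]
    exact hτ
  rw [div_le_iff₀ (hψ _ hτ0)]
  have := h.le_pow hC (x := log τ - x) (by linarith) n x (by linarith) (by linarith)
  simpa [exp_sub, exp_log hτ0] using this

lemma le_mSup_mul (hψ : ∀ x > 0, 0 < ψ x) (h : LogComparable ψ C X) (hC : 0 ≤ C) (hX : 0 ≤ X)
    {x y : ℝ} (hx : X ≤ x) (hxy : 2 * x < y) :
    ψ (exp (y - x)) ≤ mSup ψ (exp x) * ψ (exp y) := by
  rw [← div_le_iff₀ (hψ _ (exp_pos y))]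
  refine le_csSup (bddAbove_mSup hψ h hC hX hx) ⟨exp y, ?_, by rw [exp_sub]⟩
  rw [sq, ← exp_add, exp_lt_exp]
  linarith

lemma mSup_exp_add_le (hψ : ∀ x > 0, 0 < ψ x) (h : LogComparable ψ C X) (hC : 0 ≤ C)
    (hX : 0 ≤ X) {x u : ℝ} (hx : X ≤ x) (hu : u ∈ Icc (0 : ℝ) 2) :
    mSup ψ (exp (x + u)) ≤ C * mSup ψ (exp x) := by
  refine Real.sSup_le ?_ (mul_nonneg hC (mSup_nonneg hψ (exp_pos x)))
  rintro r ⟨τ, hτ, rfl⟩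
  have hτ0 : 0 < τ := (by positivity : 0 < exp (x + u) ^ 2).trans hτ
  have hlog : 2 * (x + u) < log τ := by
    rw [lt_log_iff_exp_lt hτ0, two_mul, exp_add, ← sq]
    exact hτ
  have h1 := le_mSup_mul hψ h hC hX hx (y := log τ) (by linarith [hu.1])
  have h2 := (h (log τ - (x + u)) (by linarith [hu.1]) u hu).2
  rw [show log τ - (x + u) + u = log τ - x by ring, exp_sub, exp_log hτ0] at h2
  rw [exp_log hτ0] at h1
  rw [div_le_iff₀ (hψ _ hτ0), mul_assoc]
  exact h2.trans (by gcongr)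

end mSup

/-- Counting functions control sums of almost decreasing weights over the sequence. -/
lemma summable_of_cntF_le {lam : ℕ → ℝ} {φ G : ℝ → ℝ} {p C D X : ℝ} (hp : 0 < p)
    (hpos : ∀ n, 0 < lam n) (hfin : ∀ t > 0, {n | t < lam n}.Finite)
    (hφ : ∀ x > 0, 0 < φ x) (hC : 0 ≤ C) (hD : 0 ≤ D) (hX : 0 ≤ X)
    (hcomp : LogComparable φ C X)
    (hcnt : ∀ y ≥ X, cntF lam (exp (-y)) ≤ D * φ (exp y) * exp (y / p))
    (hG : ∀ x, 0 ≤ G x) (hGC : ∀ x ≥ X, ∀ u ∈ Icc (0 : ℝ) 2, G (x + u) ≤ C * G x)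
    (hi : IntegrableOn (fun x => φ (exp x) * G x) (Ici 0)) :
    Summable fun k => if X ≤ -log (lam k) then G (-log (lam k)) * lam k ^ (1 / p) else 0 := by
  have hpow : ∀ k, lam k ^ (1 / p) = exp (-(-log (lam k)) / p) := fun k => by
    rw [rpow_def_of_pos (hpos k)]
    congr 1
    ring
  have hsum : Summable fun j : ℕ => φ (exp (X + j)) * G (X + j) := by
    refine summable_of_integrableOn_of_almost_decreasing (C := C * C)
      (P := fun x => φ (exp x) * G x) hX hi
      (fun x _ => mul_nonneg (hφ _ (exp_pos x)).le (hG x)) fun x hx u hu => ?_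
    have hu' : u ∈ Icc (0 : ℝ) 2 := ⟨hu.1, by linarith [hu.2]⟩
    calc φ (exp (x + u)) * G (x + u) ≤ (C * φ (exp x)) * (C * G x) :=
          mul_le_mul (hcomp x hx u hu').1 (hGC x hx u hu') (hG _)
            (mul_nonneg hC (hφ _ (exp_pos x)).le)
      _ = _ := by ring
  have hle : ∀ {k}, X ≤ -log (lam k) → X + ⌊-log (lam k) - X⌋₊ ≤ -log (lam k) ∧
      -log (lam k) < X + ⌊-log (lam k) - X⌋₊ + 1 := fun {k} hk => by
    have h1 := Nat.floor_le (sub_nonneg.2 hk)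
    have h2 := Nat.lt_floor_add_one (-log (lam k) - X)
    constructor <;> linarith
  refine summable_of_fiber_card_le (j := fun k => ⌊-log (lam k) - X⌋₊)
    (w := fun i => C * G (X + i) * exp (-(X + i) / p))
    (c := fun i => D * (C * φ (exp (X + i))) * exp ((X + i + 1) / p)) ?_ ?_ ?_ ?_ ?_ ?_
  · intro k
    split_ifs
    · exact mul_nonneg (hG _) (rpow_nonneg (hpos k).le _)
    · exact le_rfl
  · exact fun i => mul_nonneg (mul_nonneg hC (hG _)) (exp_pos _).le
  · exact fun i => mul_nonneg (mul_nonneg hD (mul_nonneg hC (hφ _ (exp_pos _)).le)) (exp_pos _).le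
  · intro k hk
    have hk' : X ≤ -log (lam k) := by
      by_contra hcon
      exact hk (if_neg hcon)
    rw [if_pos hk', hpow]
    obtain ⟨h1, h2⟩ := hle hk'
    have h3 := hGC (X + ⌊-log (lam k) - X⌋₊) (by simp)
      (-log (lam k) - (X + ⌊-log (lam k) - X⌋₊)) ⟨by linarith, by linarith⟩
    rw [add_sub_cancel] at h3
    refine mul_le_mul h3 ?_ (exp_pos _).le (mul_nonneg hC (hG _))
    gcongr
  · intro i S hS
    have hsub : (S : Set ℕ) ⊆ {n | exp (-(X + i + 1)) < lam n} := by
      intro k hk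
      obtain ⟨hk1, hk2⟩ := hS k hk
      have hk' : X ≤ -log (lam k) := by
        by_contra hcon
        exact hk2 (if_neg hcon)
      have := (hle hk').2
      rw [hk1] at this
      change exp (-(X + i + 1)) < lam k
      rw [← lt_log_iff_exp_lt (hpos k)]
      linarith
    have hc : (S.card : ℝ) ≤ cntF lam (exp (-(X + i + 1))) := by
      have := Set.ncard_le_ncard hsub (hfin _ (exp_pos _))
      rw [Set.ncard_coe_finset] at this
      rw [cntF_eq_ncard]
      exact_mod_cast this
    have hi0 : (0 : ℝ) ≤ i := i.cast_nonneg
    refine hc.trans ((hcnt _ (by linarith)).trans ?_)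
    have := (hcomp (X + i) (by linarith) 1 ⟨by norm_num, by norm_num⟩).1
    gcongr
  · refine (hsum.mul_left (D * C * C * exp (1 / p))).congr fun i => ?_
    have : exp ((X + i + 1) / p) * exp (-(X + i) / p) = exp (1 / p) := by
      rw [← exp_add]
      congr 1
      ring
    calc _ = D * C * C * φ (exp (X + i)) * G (X + i) *
          (exp ((X + i + 1) / p) * exp (-(X + i) / p)) := by rw [this]; ring
      _ = _ := by ring

/-- The part of the tensor counting function coming from pairs with second factor above `r`. -/
lemma ncard_pairs_eq_tsum {lam lamt : ℕ → ℝ} {t r : ℝ} (ht : 0 < t) (hr : 0 < r)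
    (hpost : ∀ n, 0 < lamt n) (hfin : ∀ t > 0, {n | t < lam n}.Finite)
    (hfint : ∀ t > 0, {n | t < lamt n}.Finite) :
    {q : ℕ × ℕ | r < lamt q.2 ∧ t < lam q.1 * lamt q.2}.Finite ∧
    (({q : ℕ × ℕ | r < lamt q.2 ∧ t < lam q.1 * lamt q.2}.ncard : ℕ) : ℝ) =
      ∑' k, if r < lamt k then cntF lam (t / lamt k) else 0 := by
  set A := {q : ℕ × ℕ | r < lamt q.2 ∧ t < lam q.1 * lamt q.2} with hAdef
  have hfib : ∀ k, {n | t / lamt k < lam n}.Finite := fun k => hfin _ (div_pos ht (hpost k))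
  have hA : A.Finite := by
    refine ((hfint r hr).biUnion fun k _ => (hfib k).image fun n => (n, k)).subset ?_
    rintro ⟨n, k⟩ ⟨h1, h2⟩
    simp only [mem_iUnion]
    exact ⟨k, h1, n, (div_lt_iff₀ (hpost k)).2 h2, rfl⟩
  refine ⟨hA, ?_⟩
  have hmaps : (hA.toFinset : Set (ℕ × ℕ)).MapsTo Prod.snd (hfint r hr).toFinset := by
    rintro ⟨n, k⟩ h
    simp only [Finite.coe_toFinset] at h ⊢
    exact h.1
  rw [ncard_eq_toFinset_card A hA, Finset.card_eq_sum_card_fiberwise hmaps,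
    tsum_eq_sum (s := (hfint r hr).toFinset)]
  · push_cast
    refine Finset.sum_congr rfl fun k hk => ?_
    have hk' : r < lamt k := by simpa using hk
    rw [if_pos hk', cntF_eq_ncard, ncard_eq_toFinset_card _ (hfib k)]
    congr 1
    refine Finset.card_nbij' (fun q => q.1) (fun n => (n, k)) ?_ ?_ ?_ ?_
    · rintro ⟨n, k'⟩ h
      simp only [Finset.coe_filter, Finite.mem_toFinset, mem_ofPred_eq, hAdef] at h
      obtain ⟨⟨_, h⟩, rfl⟩ := h
      simpa [div_lt_iff₀ (hpost _)] using h
    · intro n h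
      simp only [Finite.coe_toFinset, mem_ofPred_eq, div_lt_iff₀ (hpost _)] at h
      simp [hAdef, hk', h]
    · rintro ⟨n, k'⟩ h
      simp only [Finset.coe_filter, mem_ofPred_eq] at h
      simp [h.2]
    · intro n _
      rfl
  · intro k hk
    rw [if_neg]
    simpa using hk

/-- The hyperbola method for the counting function of a tensor product. -/
lemma cntTensor_eq {lam lamt : ℕ → ℝ} {r : ℝ} (hr : 0 < r)
    (hpos : ∀ n, 0 < lam n) (hpost : ∀ n, 0 < lamt n) (hfin : ∀ t > 0, {n | t < lam n}.Finite)
    (hfint : ∀ t > 0, {n | t < lamt n}.Finite) :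
    cntTensor lam lamt (r * r) =
      (∑' k, if r < lamt k then cntF lam (r * r / lamt k) else 0) +
      (∑' n, if r < lam n then cntF lamt (r * r / lam n) else 0) -
      cntF lam r * cntF lamt r := by
  have ht : 0 < r * r := mul_pos hr hr
  obtain ⟨hA, hAc⟩ := ncard_pairs_eq_tsum ht hr hpost hfin hfint
  obtain ⟨hB, hBc⟩ := ncard_pairs_eq_tsum ht hr hpos hfint hfin
  rw [← hAc, ← hBc]
  set A := {q : ℕ × ℕ | r < lamt q.2 ∧ r * r < lam q.1 * lamt q.2} with hAdef
  set B := {q : ℕ × ℕ | r < lam q.2 ∧ r * r < lamt q.1 * lam q.2} with hBdef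
  have hU : {q : ℕ × ℕ | r * r < lam q.1 * lamt q.2} = A ∪ Prod.swap '' B := by
    ext ⟨n, k⟩
    simp only [mem_ofPred_eq, hAdef, hBdef, image_swap_eq_preimage_swap, mem_union, mem_preimage,
      Prod.fst_swap, Prod.snd_swap, mul_comm (lamt k)]
    constructor
    · intro h
      by_contra! hcon
      have h1 : lamt k ≤ r := not_lt.1 fun h' => absurd h (not_lt.2 (hcon.1 h'))
      have h2 : lam n ≤ r := not_lt.1 fun h' => absurd h (not_lt.2 (hcon.2 h'))
      exact absurd h (not_lt.2 (mul_le_mul h2 h1 (hpost k).le hr.le))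
    · rintro (h | h) <;> exact h.2
  have hI : A ∩ Prod.swap '' B = {n | r < lam n} ×ˢ {k | r < lamt k} := by
    ext ⟨n, k⟩
    simp only [mem_ofPred_eq, hAdef, hBdef, image_swap_eq_preimage_swap, mem_inter_iff,
      mem_preimage, Prod.fst_swap, Prod.snd_swap, mul_comm (lamt k), mem_prod]
    constructor
    · rintro ⟨h1, h2⟩
      exact ⟨h2.1, h1.1⟩
    · rintro ⟨h1, h2⟩
      have := mul_lt_mul'' h1 h2 hr.le hr.le
      exact ⟨⟨h2, this⟩, h1, this⟩
  have h := ncard_union_add_ncard_inter A (Prod.swap '' B) hA (hB.image _)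
  rw [← hU, hI, ncard_prod, ncard_image_of_injective _ Prod.swap_injective] at h
  have h' : cntTensor lam lamt (r * r) + cntF lam r * cntF lamt r = A.ncard + B.ncard := by
    rw [cntF_eq_ncard, cntF_eq_ncard]
    change (({q : ℕ × ℕ | r * r < lam q.1 * lamt q.2}.ncard : ℕ) : ℝ) + _ = _
    exact_mod_cast h
  linarith

lemma cntF_nonneg (lam : ℕ → ℝ) (t : ℝ) : 0 ≤ cntF lam t := Nat.cast_nonneg _

lemma exists_cntF_le {lam : ℕ → ℝ} {φ s : ℝ → ℝ} {p M : ℝ} (hφ : IsSVF φ)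
    (hs : ∀ y, 0 < s y) (hsM : ∀ y, s y ≤ M)
    (hN : (fun y => cntF lam (exp (-y))) ~[atTop] fun y => φ (exp y) * s y * exp (y / p)) :
    ∃ Y, ∀ y ≥ Y, cntF lam (exp (-y)) ≤ 2 * M * φ (exp y) * exp (y / p) := by
  have hφ0 : ∀ y, 0 < φ (exp y) := fun y => hφ.1 _ (exp_pos y)
  have hV : ∀ y, 0 < φ (exp y) * s y * exp (y / p) := fun y =>
    mul_pos (mul_pos (hφ0 y) (hs y)) (exp_pos _)
  have hR := (isEquivalent_iff_tendsto_one (Eventually.of_forall fun y => (hV y).ne')).1 hN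
  obtain ⟨Y, hY⟩ := eventually_atTop.1 (hR.eventually (gt_mem_nhds one_lt_two))
  refine ⟨Y, fun y hy => ?_⟩
  have h1 := (div_lt_iff₀ (hV y)).1 (hY y hy)
  calc _ ≤ 2 * (φ (exp y) * s y * exp (y / p)) := h1.le
    _ ≤ 2 * (φ (exp y) * M * exp (y / p)) := by
      have := hsM y
      have := hφ0 y
      gcongr
    _ = _ := by ring

/-- Asymptotics of the part of the tensor counting function with the second factor large, by
dominated convergence. -/
lemma isLittleO_tsum_cntF {lam lamt : ℕ → ℝ} {φ s G : ℝ → ℝ} {p m M X : ℝ}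
    (hpost : ∀ n, 0 < lamt n) (hfint : ∀ t > 0, {n | t < lamt n}.Finite)
    (hφ : IsSVF φ) (hm : 0 < m) (hsm : ∀ y, m ≤ s y) (hsM : ∀ y, s y ≤ M)
    (hN : (fun y => cntF lam (exp (-y))) ~[atTop] fun y => φ (exp y) * s y * exp (y / p))
    (hG0 : ∀ x, 0 ≤ G x)
    (hG : ∀ x ≥ X, ∀ y, 2 * x < y → φ (exp (y - x)) ≤ G x * φ (exp y))
    (hGsum : Summable fun k =>
      if X ≤ -log (lamt k) then G (-log (lamt k)) * lamt k ^ (1 / p) else 0)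
    (hsum : Summable fun k => lamt k ^ (1 / p)) :
    (fun y => (∑' k, if exp (-(y / 2)) < lamt k then cntF lam (exp (-y) / lamt k) else 0) -
        φ (exp y) * (∑' k, s (y + log (lamt k)) * lamt k ^ (1 / p)) * exp (y / p))
      =o[atTop] fun y => φ (exp y) * exp (y / p) := by
  have hφ0 : ∀ y, 0 < φ (exp y) := fun y => hφ.1 _ (exp_pos y)
  have hs0 : ∀ y, 0 < s y := fun y => hm.trans_le (hsm y)
  have hM : 0 < M := hm.trans_le ((hsm 0).trans (hsM 0))
  have hE : ∀ k, 0 < lamt k ^ (1 / p) := fun k => rpow_pos_of_pos (hpost k) _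
  have hpow : ∀ k, lamt k ^ (1 / p) = exp (log (lamt k) / p) := fun k => by
    rw [rpow_def_of_pos (hpost k)]
    congr 1
    ring
  have hdiv : ∀ y k, exp (-y) / lamt k = exp (-(y + log (lamt k))) := fun y k => by
    rw [neg_add, exp_add, exp_neg (log _), exp_log (hpost k), div_eq_mul_inv]
  have hV : ∀ y, φ (exp y) * s y * exp (y / p) ≠ 0 := fun y =>
    (mul_pos (mul_pos (hφ0 y) (hs0 y)) (exp_pos _)).ne'
  have hR := (isEquivalent_iff_tendsto_one (Eventually.of_forall hV)).1 hN
  obtain ⟨Y, hbound⟩ := exists_cntF_le hφ hs0 hsM hN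
  set a : ℝ → ℕ → ℝ := fun y k =>
    (if exp (-(y / 2)) < lamt k then cntF lam (exp (-y) / lamt k) else 0) /
      (φ (exp y) * exp (y / p)) with ha
  set b : ℝ → ℕ → ℝ := fun y k => s (y + log (lamt k)) * lamt k ^ (1 / p) with hb
  have hb0 : ∀ y k, 0 ≤ b y k := fun y k => mul_nonneg (hs0 _).le (hE k).le
  have hbM : ∀ y k, b y k ≤ M * lamt k ^ (1 / p) := fun y k =>
    mul_le_mul_of_nonneg_right (hsM _) (hE k).le
  have hbs : ∀ y, Summable (b y) := fun y =>
    Summable.of_nonneg_of_le (hb0 y) (hbM y) (hsum.mul_left M)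
  have has : ∀ y, Summable (a y) := fun y => by
    refine summable_of_hasFiniteSupport ((hfint _ (exp_pos (-(y / 2)))).subset fun k hk => ?_)
    by_contra hcon
    change ¬ exp (-(y / 2)) < lamt k at hcon
    exact hk (by simp only [ha]; rw [if_neg hcon, zero_div])
  have hcond : ∀ y k, exp (-(y / 2)) < lamt k ↔ -(y / 2) < log (lamt k) := fun y k =>
    (lt_log_iff_exp_lt (hpost k)).symm
  have hpt : ∀ k, Tendsto (fun y => a y k - b y k) atTop (nhds 0) := by
    intro k
    have h1 := (hR.comp (tendsto_atTop_add_const_right atTop (log (lamt k)) tendsto_id)).mul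
      (hφ.tendsto_add (log (lamt k)))
    have h2 := (h1.sub_const 1)
    rw [one_mul, sub_self] at h2
    have h3 := h2.zero_mul_isBoundedUnder_le (g := fun y => b y k)
      (isBoundedUnder_of ⟨M * lamt k ^ (1 / p), fun y => by
        simpa [abs_of_nonneg (hb0 y k)] using hbM y k⟩)
    refine h3.congr' ?_
    filter_upwards [eventually_gt_atTop (-2 * log (lamt k))] with y hy
    have hc : exp (-(y / 2)) < lamt k := (hcond y k).2 (by linarith)
    simp only [ha, hb, if_pos hc, hdiv, Function.comp_apply, Pi.div_apply, id]
    have e1 := (hφ0 y).ne'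
    have e2 := (hφ0 (y + log (lamt k))).ne'
    have e3 := (hs0 (y + log (lamt k))).ne'
    have e4 : exp ((y + log (lamt k)) / p) = exp (y / p) * lamt k ^ (1 / p) := by
      rw [hpow, ← exp_add]
      congr 1
      ring
    have e5 := (hE k).ne'
    have e6 := (exp_pos (y / p)).ne'
    rw [e4]
    field_simp
  have hfinX : {k | -log (lamt k) < X}.Finite := by
    refine (hfint _ (exp_pos (-X))).subset fun k hk => ?_
    have hk' : -log (lamt k) < X := hk
    exact (lt_log_iff_exp_lt (hpost k)).1 (by linarith)
  have hsmall : ∀ᶠ y in atTop, ∀ k ∈ {k | -log (lamt k) < X},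
      φ (exp (y + log (lamt k))) / φ (exp y) < 2 :=
    (eventually_all_finite hfinX).2 fun k _ =>
      (hφ.tendsto_add _).eventually (gt_mem_nhds one_lt_two)
  have hdom : ∀ᶠ y in atTop, ∀ k, ‖a y k - b y k‖ ≤
      2 * M * (2 * lamt k ^ (1 / p) +
        (if X ≤ -log (lamt k) then G (-log (lamt k)) * lamt k ^ (1 / p) else 0)) +
      M * lamt k ^ (1 / p) := by
    filter_upwards [hsmall, eventually_ge_atTop (2 * Y)] with y hy1 hy2 k
    have hg0 : 0 ≤ (if X ≤ -log (lamt k) then G (-log (lamt k)) * lamt k ^ (1 / p) else 0) := by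
      split_ifs
      · exact mul_nonneg (hG0 _) (hE k).le
      · exact le_rfl
    have hden : 0 < φ (exp y) * exp (y / p) := mul_pos (hφ0 y) (exp_pos _)
    have ha0 : 0 ≤ a y k := by
      refine div_nonneg ?_ hden.le
      split_ifs
      · exact cntF_nonneg _ _
      · exact le_rfl
    have hale : a y k ≤ 2 * M * (2 * lamt k ^ (1 / p) +
        (if X ≤ -log (lamt k) then G (-log (lamt k)) * lamt k ^ (1 / p) else 0)) := by
      by_cases hc : exp (-(y / 2)) < lamt k
      · have hc' := (hcond y k).1 hc
        have h1 := hbound (y + log (lamt k)) (by linarith)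
        have h2 : φ (exp (y + log (lamt k))) * lamt k ^ (1 / p) ≤ (2 * lamt k ^ (1 / p) +
            (if X ≤ -log (lamt k) then G (-log (lamt k)) * lamt k ^ (1 / p) else 0)) *
            φ (exp y) := by
          by_cases hk : X ≤ -log (lamt k)
          · rw [if_pos hk]
            have h3 := hG _ hk y (by linarith)
            rw [sub_neg_eq_add] at h3
            have h4 := mul_le_mul_of_nonneg_right h3 (hE k).le
            have h5 := mul_pos (hE k) (hφ0 y)
            linarith
          · rw [if_neg hk]
            have h3 := (div_lt_iff₀ (hφ0 y)).1 (hy1 k (not_le.1 hk))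
            have h4 := mul_le_mul_of_nonneg_right h3.le (hE k).le
            linarith
        simp only [ha, if_pos hc, hdiv]
        rw [div_le_iff₀ hden]
        refine h1.trans ?_
        have e4 : exp ((y + log (lamt k)) / p) = exp (y / p) * lamt k ^ (1 / p) := by
          rw [hpow, ← exp_add]
          congr 1
          ring
        rw [e4]
        have h6 := mul_le_mul_of_nonneg_left h2
          (mul_pos (mul_pos two_pos hM) (exp_pos (y / p))).le
        linarith
      · simp only [ha, if_neg hc, zero_div]
        have := (hE k).le
        positivity
    rw [Real.norm_eq_abs]
    refine (abs_sub _ _).trans ?_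
    rw [abs_of_nonneg ha0, abs_of_nonneg (hb0 y k)]
    exact add_le_add hale (hbM y k)
  have hlim := tendsto_tsum_of_dominated_convergence
    ((((hsum.mul_left 2).add hGsum).mul_left (2 * M)).add (hsum.mul_left M)) hpt hdom
  rw [tsum_zero] at hlim
  rw [isLittleO_iff_tendsto fun y h =>
    absurd h (mul_pos (hφ0 y) (exp_pos (y / p))).ne']
  refine hlim.congr fun y => ?_
  rw [(has y).tsum_sub (hbs y)]
  simp only [ha, hb, tsum_div_const]
  have e1 := (hφ0 y).ne'
  have e6 := (exp_pos (y / p)).ne'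
  field_simp

/-- One half of the hyperbola method: contribution of the pairs with large second factor, and
negligibility of the doubly counted pairs. -/
lemma tensor_half_asymptotics {lam lamt : ℕ → ℝ} {φ φt s st : ℝ → ℝ} {p m M Mt : ℝ}
    (hp : 0 < p) (hpost : ∀ n, 0 < lamt n) (hfint : ∀ t > 0, {n | t < lamt n}.Finite)
    (hφ : IsSVF φ) (hφt : IsSVF φt)
    (hconvφ : IntegrableOn (fun τ => φ τ / τ) (Ici 1))
    (hconvφt : IntegrableOn (fun τ => φt τ / τ) (Ici 1))
    (hmt : IntegrableOn (fun σ => φt σ * mSup φ σ / σ) (Ici 1))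
    (hm : 0 < m) (hsm : ∀ y, m ≤ s y) (hsM : ∀ y, s y ≤ M)
    (hst : ∀ y, 0 < st y) (hstM : ∀ y, st y ≤ Mt)
    (hN : (fun y => cntF lam (exp (-y))) ~[atTop] fun y => φ (exp y) * s y * exp (y / p))
    (hNt : (fun y => cntF lamt (exp (-y))) ~[atTop] fun y => φt (exp y) * st y * exp (y / p)) :
    Summable (fun k => lamt k ^ (1 / p)) ∧
    ((fun y => (∑' k, if exp (-(y / 2)) < lamt k then cntF lam (exp (-y) / lamt k) else 0) -
        φ (exp y) * (∑' k, s (y + log (lamt k)) * lamt k ^ (1 / p)) * exp (y / p))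
      =o[atTop] fun y => φ (exp y) * exp (y / p)) ∧
    (fun y => cntF lam (exp (-(y / 2))) * cntF lamt (exp (-(y / 2))))
      =o[atTop] fun y => φ (exp y) * exp (y / p) := by
  have hφ0 : ∀ y, 0 < φ (exp y) := fun y => hφ.1 _ (exp_pos y)
  have hφt0 : ∀ y, 0 < φt (exp y) := fun y => hφt.1 _ (exp_pos y)
  have hs0 : ∀ y, 0 < s y := fun y => hm.trans_le (hsm y)
  have hM : 0 < M := (hs0 0).trans_le (hsM 0)
  have hMt : 0 < Mt := (hst 0).trans_le (hstM 0)
  obtain ⟨X₁, h₁⟩ := hφ.exists_logComparable hconvφ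
  obtain ⟨X₂, h₂⟩ := hφt.exists_logComparable hconvφt
  obtain ⟨Y₁, hY₁⟩ := exists_cntF_le hφ hs0 hsM hN
  obtain ⟨Y₂, hY₂⟩ := exists_cntF_le hφt hst hstM hNt
  obtain ⟨X, hX⟩ : ∃ X, X = max 0 (max (max X₁ X₂) (max Y₁ Y₂)) := ⟨_, rfl⟩
  have hX0 : 0 ≤ X := hX ▸ le_max_left _ _
  have hXX₁ : X₁ ≤ X := by simp [hX]
  have hXX₂ : X₂ ≤ X := by simp [hX]
  have hXY₁ : Y₁ ≤ X := by simp [hX]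
  have hXY₂ : Y₂ ≤ X := by simp [hX]
  replace h₁ := h₁.mono hXX₁
  replace h₂ := h₂.mono hXX₂
  have hC : (0 : ℝ) ≤ exp 2 := (exp_pos 2).le
  set G : ℝ → ℝ := fun x => mSup φ (exp x) with hGdef
  have hG0 : ∀ x, 0 ≤ G x := fun x => mSup_nonneg hφ.1 (exp_pos x)
  have hG : ∀ x ≥ X, ∀ y, 2 * x < y → φ (exp (y - x)) ≤ G x * φ (exp y) := fun x hx y hy =>
    le_mSup_mul hφ.1 h₁ hC hX0 hx hy
  have hGC : ∀ x ≥ X, ∀ u ∈ Icc (0 : ℝ) 2, G (x + u) ≤ exp 2 * G x := fun x hx u hu =>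
    mSup_exp_add_le hφ.1 h₁ hC hX0 hx hu
  have hInt : IntegrableOn (fun x => φt (exp x) * G x) (Ici 0) :=
    integrableOn_comp_exp (g := fun σ => φt σ * mSup φ σ) hmt
  have hcnt : ∀ y ≥ X, cntF lamt (exp (-y)) ≤ 2 * Mt * φt (exp y) * exp (y / p) :=
    fun y hy => hY₂ y (hXY₂.trans hy)
  have hGsum := summable_of_cntF_le hp hpost hfint hφt.1 hC (by positivity) hX0 h₂ hcnt hG0 hGC
    hInt
  have hEsum : Summable fun k => lamt k ^ (1 / p) := by
    have h := summable_of_cntF_le (G := fun _ => 1) hp hpost hfint hφt.1 hC (by positivity) hX0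
      h₂ hcnt (fun _ => zero_le_one) (fun x _ u _ => by
        rw [mul_one]
        exact one_le_exp (by norm_num)) (by simpa using integrableOn_comp_exp hconvφt)
    have h' : Summable fun k => if X ≤ -log (lamt k) then 0 else lamt k ^ (1 / p) := by
      refine summable_of_hasFiniteSupport ((hfint _ (exp_pos (-X))).subset fun k hk => ?_)
      have hk' : ¬ X ≤ -log (lamt k) := fun hcon => hk (if_pos hcon)
      exact (lt_log_iff_exp_lt (hpost k)).1 (by linarith)
    refine (h.add h').congr fun k => ?_
    split_ifs <;> simp
  refine ⟨hEsum, isLittleO_tsum_cntF hpost hfint hφ hm hsm hsM hN hG0 hG hGsum hEsum, ?_⟩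
  have hP : Tendsto (fun x => φt (exp x) * G x) atTop (nhds 0) := by
    refine tendsto_zero_of_integrableOn_of_almost_decreasing (C := exp 2 * exp 2) hX0 hInt
      (fun x _ => mul_nonneg (hφt0 x).le (hG0 x)) fun x hx u hu => ?_
    have hu' : u ∈ Icc (0 : ℝ) 2 := ⟨hu.1, by linarith [hu.2]⟩
    calc φt (exp (x + u)) * G (x + u) ≤ (exp 2 * φt (exp x)) * (exp 2 * G x) :=
          mul_le_mul (h₂ x hx u hu').1 (hGC x hx u hu') (hG0 _) (mul_nonneg hC (hφt0 x).le)
      _ = _ := by ring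
  have hP' : Tendsto (fun y => 2 * M * (2 * Mt) * (exp 2 * exp 2) *
      (φt (exp (y / 2 - 1)) * G (y / 2 - 1))) atTop (nhds 0) := by
    have := (hP.comp (tendsto_atTop_add_const_right atTop (-1)
      (tendsto_id.atTop_div_const two_pos))).const_mul (2 * M * (2 * Mt) * (exp 2 * exp 2))
    simpa [Function.comp_def, ← sub_eq_add_neg] using this
  rw [isLittleO_iff_tendsto fun y h => absurd h (mul_pos (hφ0 y) (exp_pos (y / p))).ne']
  refine squeeze_zero' (Eventually.of_forall fun y => div_nonneg
    (mul_nonneg (cntF_nonneg _ _) (cntF_nonneg _ _))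
    (mul_pos (hφ0 y) (exp_pos (y / p))).le) ?_ hP'
  filter_upwards [eventually_ge_atTop (2 * (X + 1))] with y hy
  rw [div_le_iff₀ (mul_pos (hφ0 y) (exp_pos _))]
  have e1 := hY₁ (y / 2) (by linarith)
  have e2 := hcnt (y / 2) (by linarith)
  have e3 : φ (exp (y / 2)) ≤ exp 2 * (G (y / 2 - 1) * φ (exp y)) := by
    have a1 := (h₁ (y / 2) (by linarith) 1 ⟨by norm_num, by norm_num⟩).2
    have a2 := hG (y / 2 - 1) (by linarith) y (by linarith)
    rw [show y - (y / 2 - 1) = y / 2 + 1 by ring] at a2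
    exact a1.trans (mul_le_mul_of_nonneg_left a2 hC)
  have e4 : φt (exp (y / 2)) ≤ exp 2 * φt (exp (y / 2 - 1)) := by
    have := (h₂ (y / 2 - 1) (by linarith) 1 ⟨by norm_num, by norm_num⟩).1
    simpa using this
  have e5 : exp (y / p) = exp (y / 2 / p) * exp (y / 2 / p) := by
    rw [← exp_add]
    congr 1
    ring
  have hg := hG0 (y / 2 - 1)
  have hf := hφ0 y
  have hf2 := hφ0 (y / 2)
  have hft := hφt0 (y / 2 - 1)
  have hft2 := hφt0 (y / 2)
  calc cntF lam (exp (-(y / 2))) * cntF lamt (exp (-(y / 2)))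
      ≤ (2 * M * φ (exp (y / 2)) * exp (y / 2 / p)) *
        (2 * Mt * φt (exp (y / 2)) * exp (y / 2 / p)) :=
        mul_le_mul e1 e2 (cntF_nonneg _ _) (by positivity)
    _ ≤ (2 * M * (exp 2 * (G (y / 2 - 1) * φ (exp y))) * exp (y / 2 / p)) *
        (2 * Mt * (exp 2 * φt (exp (y / 2 - 1))) * exp (y / 2 / p)) := by gcongr
    _ = _ := by
        rw [e5]
        ring

lemma mul_le_tsum_shift {lamt : ℕ → ℝ} {s : ℝ → ℝ} {p m M : ℝ} (hpost : ∀ n, 0 < lamt n)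
    (hm : 0 < m) (hsm : ∀ y, m ≤ s y) (hsM : ∀ y, s y ≤ M)
    (hsum : Summable fun k => lamt k ^ (1 / p)) (y : ℝ) :
    Summable (fun k => s (y + log (lamt k)) * lamt k ^ (1 / p)) ∧
    m * lamt 0 ^ (1 / p) ≤ ∑' k, s (y + log (lamt k)) * lamt k ^ (1 / p) := by
  have h0 : ∀ k, 0 ≤ s (y + log (lamt k)) * lamt k ^ (1 / p) := fun k =>
    mul_nonneg (hm.le.trans (hsm _)) (rpow_nonneg (hpost k).le _)
  have hs : Summable (fun k => s (y + log (lamt k)) * lamt k ^ (1 / p)) :=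
    Summable.of_nonneg_of_le h0
      (fun k => mul_le_mul_of_nonneg_right (hsM _) (rpow_nonneg (hpost k).le _))
      (hsum.mul_left M)
  exact ⟨hs, (mul_le_mul_of_nonneg_right (hsm _) (rpow_nonneg (hpost 0).le _)).trans
    (hs.le_tsum 0 fun k _ => h0 k)⟩

lemma isEquivalent_comp_exp_neg {F φ s : ℝ → ℝ} {p : ℝ}
    (h : F ~[nhdsWithin (0 : ℝ) (Ioi 0)]
      fun t => φ (1 / t) * s (log (1 / t)) / t ^ (1 / p)) :
    (fun y => F (exp (-y))) ~[atTop] fun y => φ (exp y) * s y * exp (y / p) := by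
  have := h.comp_tendsto (tendsto_exp_atBot_nhdsGT.comp tendsto_neg_atTop_atBot)
  refine this.congr_right (Eventually.of_forall fun y => ?_)
  simp only [Function.comp_apply]
  rw [one_div (exp (-y)), ← exp_neg, neg_neg, log_exp, ← exp_mul, div_eq_mul_inv, ← exp_neg]
  congr 2
  ring

lemma finite_setOf_lt_of_summable {lam : ℕ → ℝ} (hsum : Summable lam) :
    ∀ t > 0, {n | t < lam n}.Finite := by
  intro t ht
  have h := hsum.tendsto_cofinite_zero.eventually (gt_mem_nhds ht)
  refine (eventually_cofinite.1 h).subset fun n hn => ?_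
  exact not_lt.2 (le_of_lt hn)

/-- Theorem 7: both SVF integrals convergent and both Karamata-type
conditions hold.  Then
`N_⊗(t) ~ [φ(1/t) s*(ln(1/t)) + φ̃(1/t) s̃*(ln(1/t))]/t^{1/p}` where
`s*(τ) = Σ_k s(τ + ln λ̃_k) λ̃_k^{1/p}` and `s̃*(τ) = Σ_n s̃(τ + ln λ_n) λ_n^{1/p}`. -/
theorem stmt16 (p T Tt : ℝ) (hp : 0 < p) (hT : 0 < T) (hTt : 0 < Tt)
    (lam lamt : ℕ → ℝ)
    (hpos : ∀ n, 0 < lam n) (hpost : ∀ n, 0 < lamt n)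
    (hmono : Antitone lam) (hmonot : Antitone lamt)
    (hsum : Summable lam) (hsumt : Summable lamt)
    (φ φt s st ρ ρt : ℝ → ℝ)
    (hφ : IsSVF φ) (hφt : IsSVF φt)
    (hconvφ : MeasureTheory.IntegrableOn (fun τ => φ τ / τ) (Set.Ici 1)
      MeasureTheory.volume)
    (hconvφt : MeasureTheory.IntegrableOn (fun τ => φt τ / τ) (Set.Ici 1)
      MeasureTheory.volume)
    (hm : MeasureTheory.IntegrableOn (fun σ => φ σ * mSup φt σ / σ) (Set.Ici 1)
      MeasureTheory.volume)
    (hmt : MeasureTheory.IntegrableOn (fun σ => φt σ * mSup φ σ / σ) (Set.Ici 1)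
      MeasureTheory.volume)
    (hs : Continuous s) (hst : Continuous st)
    (hsper : Function.Periodic s T) (hstper : Function.Periodic st Tt)
    (hsb : ∃ m M : ℝ, 0 < m ∧ ∀ τ, m ≤ s τ ∧ s τ ≤ M)
    (hstb : ∃ m M : ℝ, 0 < m ∧ ∀ τ, m ≤ st τ ∧ st τ ≤ M)
    (hρ : Monotone ρ) (hρt : Monotone ρt)
    (hρc : Continuous ρ) (hρtc : Continuous ρt)
    (hsform : ∀ τ, s τ = Real.exp (-τ / p) * ρ τ)
    (hstform : ∀ τ, st τ = Real.exp (-τ / p) * ρt τ)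
    (hN : cntF lam ~[nhdsWithin (0:ℝ) (Set.Ioi 0)]
      (fun t => φ (1 / t) * s (Real.log (1 / t)) / t ^ (1 / p)))
    (hNt : cntF lamt ~[nhdsWithin (0:ℝ) (Set.Ioi 0)]
      (fun t => φt (1 / t) * st (Real.log (1 / t)) / t ^ (1 / p))) :
    (∀ τ : ℝ, Summable (fun k => s (τ + Real.log (lamt k)) * lamt k ^ (1 / p))) ∧
    (∀ τ : ℝ, Summable (fun n => st (τ + Real.log (lam n)) * lam n ^ (1 / p))) ∧
    cntTensor lam lamt ~[nhdsWithin (0:ℝ) (Set.Ioi 0)]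
      (fun t => (φ (1 / t) *
            (∑' k, s (Real.log (1 / t) + Real.log (lamt k)) * lamt k ^ (1 / p)) +
          φt (1 / t) *
            (∑' n, st (Real.log (1 / t) + Real.log (lam n)) * lam n ^ (1 / p))) /
        t ^ (1 / p)) := by
  obtain ⟨m, M, hm0, hsb⟩ := hsb
  obtain ⟨mt, Mt, hmt0, hstb⟩ := hstb
  have hsm := fun y => (hsb y).1
  have hsM := fun y => (hsb y).2
  have hstm := fun y => (hstb y).1
  have hstM := fun y => (hstb y).2
  have hfin := finite_setOf_lt_of_summable hsum
  have hfint := finite_setOf_lt_of_summable hsumt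
  have hN' := isEquivalent_comp_exp_neg hN
  have hNt' := isEquivalent_comp_exp_neg hNt
  obtain ⟨hE, hO, hcorr⟩ := tensor_half_asymptotics hp hpost hfint hφ hφt hconvφ hconvφt hmt hm0
    hsm hsM (fun y => hmt0.trans_le (hstm y)) hstM hN' hNt'
  obtain ⟨hEt, hOt, -⟩ := tensor_half_asymptotics hp hpos hfin hφt hφ hconvφt hconvφ hm hmt0
    hstm hstM (fun y => hm0.trans_le (hsm y)) hsM hNt' hN'
  have hS := mul_le_tsum_shift hpost hm0 hsm hsM hE
  have hSt := mul_le_tsum_shift hpos hmt0 hstm hstM hEt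
  refine ⟨fun τ => (hS τ).1, fun τ => (hSt τ).1, ?_⟩
  set S : ℝ → ℝ := fun y => ∑' k, s (y + log (lamt k)) * lamt k ^ (1 / p) with hSdef
  set St : ℝ → ℝ := fun y => ∑' n, st (y + log (lam n)) * lam n ^ (1 / p) with hStdef
  set V : ℝ → ℝ := fun y => (φ (exp y) * S y + φt (exp y) * St y) * exp (y / p) with hV
  have hφ0 : ∀ y, 0 < φ (exp y) := fun y => hφ.1 _ (exp_pos y)
  have hφt0 : ∀ y, 0 < φt (exp y) := fun y => hφt.1 _ (exp_pos y)
  have hc : 0 < m * lamt 0 ^ (1 / p) := mul_pos hm0 (rpow_pos_of_pos (hpost 0) _)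
  have hct : 0 < mt * lam 0 ^ (1 / p) := mul_pos hmt0 (rpow_pos_of_pos (hpos 0) _)
  have hS0 : ∀ y, 0 < S y := fun y => hc.trans_le (hS y).2
  have hSt0 : ∀ y, 0 < St y := fun y => hct.trans_le (hSt y).2
  have hV0 : ∀ y, 0 < V y := fun y => mul_pos
    (add_pos (mul_pos (hφ0 y) (hS0 y)) (mul_pos (hφt0 y) (hSt0 y))) (exp_pos _)
  have hb : (fun y => φ (exp y) * exp (y / p)) =O[atTop] V := by
    refine IsBigO.of_bound (m * lamt 0 ^ (1 / p))⁻¹ (Eventually.of_forall fun y => ?_)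
    rw [norm_of_nonneg (mul_pos (hφ0 y) (exp_pos _)).le, norm_of_nonneg (hV0 y).le,
      ← div_eq_inv_mul, le_div_iff₀ hc]
    have h1 := mul_le_mul_of_nonneg_left (hS y).2 (mul_pos (hφ0 y) (exp_pos (y / p))).le
    have h2 := mul_pos (mul_pos (hφt0 y) (hSt0 y)) (exp_pos (y / p))
    have h3 : V y = φ (exp y) * exp (y / p) * S y + φt (exp y) * St y * exp (y / p) := by
      rw [hV]
      ring
    linarith
  have hbt : (fun y => φt (exp y) * exp (y / p)) =O[atTop] V := by
    refine IsBigO.of_bound (mt * lam 0 ^ (1 / p))⁻¹ (Eventually.of_forall fun y => ?_)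
    rw [norm_of_nonneg (mul_pos (hφt0 y) (exp_pos _)).le, norm_of_nonneg (hV0 y).le,
      ← div_eq_inv_mul, le_div_iff₀ hct]
    have h1 := mul_le_mul_of_nonneg_left (hSt y).2 (mul_pos (hφt0 y) (exp_pos (y / p))).le
    have h2 := mul_pos (mul_pos (hφ0 y) (hS0 y)) (exp_pos (y / p))
    have h3 : V y = φt (exp y) * exp (y / p) * St y + φ (exp y) * S y * exp (y / p) := by
      rw [hV]
      ring
    linarith
  have hmain : (fun y => cntTensor lam lamt (exp (-y))) ~[atTop] V := by
    refine (((hO.trans_isBigO hb).add (hOt.trans_isBigO hbt)).sub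
      (hcorr.trans_isBigO hb)).congr_left fun y => ?_
    have hr : exp (-y) = exp (-(y / 2)) * exp (-(y / 2)) := by
      rw [← exp_add]
      congr 1
      ring
    simp only [Pi.sub_apply, hV, hSdef, hStdef]
    rw [hr, cntTensor_eq (exp_pos _) hpos hpost hfin hfint]
    ring
  have hlog : Tendsto (fun t => -log t) (nhdsWithin (0 : ℝ) (Ioi 0)) atTop :=
    tendsto_neg_atBot_atTop.comp tendsto_log_nhdsGT_zero
  have := hmain.comp_tendsto hlog
  refine (this.congr_left ?_).congr_right ?_
  · filter_upwards [self_mem_nhdsWithin] with t ht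
    simp [exp_log (mem_Ioi.1 ht)]
  · filter_upwards [self_mem_nhdsWithin] with t ht
    have ht' : 0 < t := ht
    have e1 : exp (-log t / p) = (t ^ (1 / p))⁻¹ := by
      rw [rpow_def_of_pos ht', ← exp_neg]
      congr 1
      ring
    simp only [Function.comp_apply, hV, hSdef, hStdef, e1, exp_neg, exp_log ht', one_div t,
      log_inv, div_eq_mul_inv _ (t ^ (1 / p))]
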